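/- Let p be a positive integer, S ⊆ {1,…,p}, and let L : ℝ^p → ℝ be twice continuously differentiable. Let ρ : ℝ → ℝ be (μ, γ)-amenable for some μ ≥ 0, γ > 0 and λ > 0, set q(t) := λ|t| − ρ(t) and ∇q(β) := (q'(β_j))_{j=1}^p. Let β*, β̂ ∈ ℝ^p with supp(β*) ⊆ S and supp(β̂) ⊆ S, and suppose ∇L(β̂) − ∇q(β̂) + λẑ = 0 for some ẑ ∈ ℝ^p with ẑ_S ∈ ∂‖β̂_S‖₁. Define Q̂ := ∫₀¹ ∇²L(β* + t(β̂ − β*)) dt and suppose Q̂_{SS} is invertible. If min_{j ∈ S} |β*_j| ≥ λ(γ + |||(Q̂_{SS})^{−1}|||_∞) + ‖(Q̂_{SS})^{−1}(∇L(β*))_S‖_∞, then: (1) |β̂_j| ≥ γλ for all j ∈ S; (2) (∇L(β̂))_S = 0, so that if the restriction of L to {β : supp(β) ⊆ S} is strictly convex then β̂ is its unique minimizer (the oracle estimator); and (3) ‖β̂ − β*‖_∞ ≤ ‖(Q̂_{SS})^{−1}(∇L(β*))_S‖_∞. -/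

import Mathlib

open scoped BigOperators

/-- A function `ρ : ℝ → ℝ` is `μ`-amenable (with selection parameter `lam > 0`):
(i) symmetric around zero with `ρ 0 = 0`; (ii) nondecreasing on `[0, ∞)`;
(iii) `t ↦ ρ t / t` nonincreasing on `(0, ∞)`; (iv) differentiable away from `0`;
(v) `t ↦ ρ t + μ/2 t²` convex; (vi) `ρ'(t) → lam` as `t → 0⁺`. -/
structure Amenable (lam mu : ℝ) (ρ : ℝ → ℝ) : Prop where
  symm : ∀ t : ℝ, ρ (-t) = ρ t
  zero : ρ 0 = 0
  mono : MonotoneOn ρ (Set.Ici (0 : ℝ))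
  ratio : AntitoneOn (fun t => ρ t / t) (Set.Ioi (0 : ℝ))
  diff : ∀ t : ℝ, t ≠ 0 → DifferentiableAt ℝ ρ t
  conv : ConvexOn ℝ Set.univ (fun t => ρ t + mu / 2 * t ^ 2)
  deriv_lim : Filter.Tendsto (deriv ρ) (nhdsWithin 0 (Set.Ioi 0)) (nhds lam)


open scoped RealInnerProductSpace

/-- The ℓ₁-norm on `ℝ^p`. -/
noncomputable def norm1 {p : ℕ} (x : EuclideanSpace ℝ (Fin p)) : ℝ := ∑ j, |x j|

/-- The ℓ_∞-norm on `ℝ^p`. -/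
noncomputable def normInf {p : ℕ} (x : EuclideanSpace ℝ (Fin p)) : ℝ := ⨆ j, |x j|

/-- The subdifferential of the ℓ₁-norm at `x`: vectors `v` with `‖v‖_∞ ≤ 1` and
`⟨v, x⟩ = ‖x‖₁`. -/
def l1Subdiff {m : Type*} [Fintype m] (x : m → ℝ) : Set (m → ℝ) :=
  {v | (∀ j, |v j| ≤ 1) ∧ ∑ j, v j * x j = ∑ j, |x j|}

/-- The `(α, τ)`-RSC condition for a loss `L` with parameters `α₁, α₂, τ₁, τ₂` (and `n`, `p`). -/
def RSCCond (p n : ℕ) (α₁ α₂ τ₁ τ₂ : ℝ) (L : EuclideanSpace ℝ (Fin p) → ℝ) : Prop :=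
  ∀ β Δ : EuclideanSpace ℝ (Fin p),
    (‖Δ‖ ≤ 1 → α₁ * ‖Δ‖ ^ 2 - τ₁ * (Real.log p / n) * (norm1 Δ) ^ 2 ≤
      ⟪gradient L (β + Δ) - gradient L β, Δ⟫) ∧
    (1 ≤ ‖Δ‖ → α₂ * ‖Δ‖ - τ₂ * Real.sqrt (Real.log p / n) * norm1 Δ ≤
      ⟪gradient L (β + Δ) - gradient L β, Δ⟫)

/-- The derivative of `q(t) = λ|t| − ρ(t)`. -/
noncomputable def qDeriv (lam : ℝ) (ρ : ℝ → ℝ) (t : ℝ) : ℝ :=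
  deriv (fun u => lam * |u| - ρ u) t

/-- `βt` is a stationary point of the program `min_{‖β‖₁ ≤ R} L β + Σⱼ ρ(βⱼ)`:
`‖βt‖₁ ≤ R` and there is `z ∈ ∂‖βt‖₁` with
`⟨∇L(βt) − ∇q(βt) + λ z, β − βt⟩ ≥ 0` for all feasible `β`. -/
def IsStationaryPt {p : ℕ} (L : EuclideanSpace ℝ (Fin p) → ℝ) (ρ : ℝ → ℝ) (lam R : ℝ)
    (βt : EuclideanSpace ℝ (Fin p)) : Prop :=
  norm1 βt ≤ R ∧ ∃ z : Fin p → ℝ, z ∈ l1Subdiff (fun j => βt j) ∧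
    ∀ β : EuclideanSpace ℝ (Fin p), norm1 β ≤ R →
      0 ≤ ∑ j, (gradient L βt j - qDeriv lam ρ (βt j) + lam * z j) * (β j - βt j)

/-- The Hessian matrix `∇²L(β)` of `L` at `β`. -/
noncomputable def hess {p : ℕ} (L : EuclideanSpace ℝ (Fin p) → ℝ)
    (β : EuclideanSpace ℝ (Fin p)) : Matrix (Fin p) (Fin p) ℝ :=
  fun i j => iteratedFDeriv ℝ 2 L β ![EuclideanSpace.single i 1, EuclideanSpace.single j 1]

/-- The averaged Hessian `Q̂ = ∫₀¹ ∇²L(β* + t(β̂ − β*)) dt`. -/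
noncomputable def Qhat {p : ℕ} (L : EuclideanSpace ℝ (Fin p) → ℝ)
    (βstar βhat : EuclideanSpace ℝ (Fin p)) : Matrix (Fin p) (Fin p) ℝ :=
  fun i j => ∫ t in (0 : ℝ)..1, hess L (βstar + t • (βhat - βstar)) i j

/-- The submatrix `M_{SS}` with rows and columns indexed by `S`. -/
def subSS {p : ℕ} (M : Matrix (Fin p) (Fin p) ℝ) (S : Finset (Fin p)) :
    Matrix {j // j ∈ S} {j // j ∈ S} ℝ :=
  fun i j => M i j

/-- The vector ℓ_∞-norm of a finitely indexed family. -/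
noncomputable def vecInf {m : Type*} [Fintype m] (x : m → ℝ) : ℝ := ⨆ i, |x i|

/-- The ℓ_∞-operator norm of a matrix: the maximum absolute row sum. -/
noncomputable def matInf {m n : Type*} [Fintype m] [Fintype n] (M : Matrix m n ℝ) : ℝ :=
  ⨆ i, ∑ j, |M i j|

/-- `ρ` is `(μ, γ)`-amenable: `μ`-amenable and in addition `ρ'(t) = 0` for all `t ≥ γλ`. -/
structure AmenableG (lam mu gam : ℝ) (ρ : ℝ → ℝ) extends Amenable lam mu ρ : Prop where
  gam_pos : 0 < gam
  unbiased : ∀ t : ℝ, gam * lam ≤ t → deriv ρ t = 0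

lemma deriv_zero_of_even {f : ℝ → ℝ} (hf : ∀ t, f (-t) = f t) : deriv f 0 = 0 := by
  have h : deriv (fun t => f (-t)) 0 = -deriv f (-0) := deriv_comp_neg f 0
  rw [funext hf, neg_zero] at h
  linarith

lemma deriv_neg_of_even {f : ℝ → ℝ} (hf : ∀ t, f (-t) = f t) (t : ℝ) :
    deriv f (-t) = -deriv f t := by
  have h : deriv (fun t => f (-t)) t = -deriv f (-t) := deriv_comp_neg f t
  rw [funext hf] at h
  linarith

lemma Amenable.continuous {lam mu : ℝ} {ρ : ℝ → ℝ} (h : Amenable lam mu ρ) :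
    Continuous ρ := by
  have hc : Continuous (fun t => ρ t + mu / 2 * t ^ 2) :=
    continuousOn_univ.1 (h.conv.continuousOn isOpen_univ)
  have : ρ = fun t => (ρ t + mu / 2 * t ^ 2) - mu / 2 * t ^ 2 := by
    ext t
    ring
  rw [this]
  fun_prop

lemma Amenable.deriv_nonneg {lam mu : ℝ} {ρ : ℝ → ℝ} (h : Amenable lam mu ρ)
    {t : ℝ} (ht : 0 < t) : 0 ≤ deriv ρ t := by
  rw [← derivWithin_of_mem_nhds (Ici_mem_nhds ht)]
  exact h.mono.derivWithin_nonneg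

lemma Amenable.div_le {lam mu : ℝ} {ρ : ℝ → ℝ} (h : Amenable lam mu ρ)
    {t : ℝ} (ht : 0 < t) : ρ t / t ≤ lam := by
  by_contra! hlt
  have hev : ∀ᶠ s in nhdsWithin (0 : ℝ) (Set.Ioi 0), deriv ρ s < ρ t / t :=
    h.deriv_lim.eventually (gt_mem_nhds hlt)
  obtain ⟨u, hu, hsub⟩ := mem_nhdsGT_iff_exists_Ioo_subset.1 hev
  have hu : 0 < u := hu
  have hs : 0 < min u t := lt_min hu ht
  obtain ⟨c, hc, hceq⟩ := exists_deriv_eq_slope ρ hs h.continuous.continuousOn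
    fun x hx => (h.diff x hx.1.ne').differentiableWithinAt
  have hcu : deriv ρ c < ρ t / t := hsub ⟨hc.1, hc.2.trans_le (min_le_left _ _)⟩
  have hr : ρ t / t ≤ ρ (min u t) / min u t := h.ratio hs ht (min_le_right _ _)
  rw [hceq, h.zero, sub_zero, sub_zero] at hcu
  linarith

lemma Amenable.deriv_le {lam mu : ℝ} {ρ : ℝ → ℝ} (h : Amenable lam mu ρ)
    {t : ℝ} (ht : 0 < t) : deriv ρ t ≤ lam := by
  have hd : HasDerivAt (fun s => ρ s / s) ((deriv ρ t * t - ρ t * 1) / t ^ 2) t :=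
    (h.diff t ht.ne').hasDerivAt.div (hasDerivAt_id t) ht.ne'
  have hle : derivWithin (fun s => ρ s / s) (Set.Ioi 0) t ≤ 0 := h.ratio.derivWithin_nonpos
  rw [derivWithin_of_mem_nhds (Ioi_mem_nhds ht), hd.deriv, div_nonpos_iff] at hle
  have hdiv := h.div_le ht
  rw [div_le_iff₀ ht] at hdiv
  have ht2 : 0 < t ^ 2 := by positivity
  rcases hle with hle | hle
  · linarith
  · nlinarith

lemma qDeriv_of_pos {lam mu : ℝ} {ρ : ℝ → ℝ} (h : Amenable lam mu ρ) {t : ℝ} (ht : 0 < t) :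
    qDeriv lam ρ t = lam - deriv ρ t := by
  have ha : HasDerivAt (fun u : ℝ => |u|) 1 t := hasDerivAt_abs_pos ht
  have hd := (ha.const_mul lam).sub (h.diff t ht.ne').hasDerivAt
  rw [mul_one] at hd
  exact hd.deriv

lemma Amenable.bias_even {lam mu : ℝ} {ρ : ℝ → ℝ} (h : Amenable lam mu ρ) (t : ℝ) :
    lam * |-t| - ρ (-t) = lam * |t| - ρ t := by
  rw [abs_neg, h.symm]

lemma qDeriv_zero {lam mu : ℝ} {ρ : ℝ → ℝ} (h : Amenable lam mu ρ) : qDeriv lam ρ 0 = 0 :=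
  deriv_zero_of_even h.bias_even

lemma qDeriv_neg {lam mu : ℝ} {ρ : ℝ → ℝ} (h : Amenable lam mu ρ) (t : ℝ) :
    qDeriv lam ρ (-t) = -qDeriv lam ρ t :=
  deriv_neg_of_even h.bias_even t

lemma mul_eq_abs_of_mem_l1Subdiff {m : Type*} [Fintype m] {x v : m → ℝ}
    (hv : v ∈ l1Subdiff x) (j : m) : v j * x j = |x j| := by
  have hle : ∀ i ∈ Finset.univ, v i * x i ≤ |x i| := fun i _ =>
    calc v i * x i ≤ |v i * x i| := le_abs_self _
      _ = |v i| * |x i| := abs_mul _ _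
      _ ≤ 1 * |x i| := by gcongr; exact hv.1 i
      _ = |x i| := one_mul _
  exact (Finset.sum_eq_sum_iff_of_le hle).1 hv.2 j (Finset.mem_univ j)

/-- For `t ≠ 0`, the derivative of the penalty bias at `t` has absolute value `ρ'(|t|)`. -/
lemma abs_qDeriv_sub {lam mu : ℝ} {ρ : ℝ → ℝ} (h : Amenable lam mu ρ) {t z : ℝ}
    (ht : t ≠ 0) (hz : z * t = |t|) : |qDeriv lam ρ t - lam * z| = deriv ρ |t| := by
  rcases ht.lt_or_gt with hneg | hpos
  · have hz1 : z = -1 := by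
      rw [abs_of_neg hneg] at hz
      exact mul_right_cancel₀ ht (by linarith)
    have hq := qDeriv_neg h (-t)
    rw [neg_neg, qDeriv_of_pos h (neg_pos.2 hneg)] at hq
    have hval : qDeriv lam ρ t - lam * z = deriv ρ (-t) := by
      rw [hz1]
      linarith
    rw [hval, abs_of_neg hneg, abs_of_nonneg (h.deriv_nonneg (neg_pos.2 hneg))]
  · have hz1 : z = 1 := by
      rw [abs_of_pos hpos] at hz
      exact mul_right_cancel₀ ht (by linarith)
    rw [qDeriv_of_pos h hpos, hz1, abs_of_pos hpos,
      show lam - deriv ρ t - lam * 1 = -deriv ρ t by ring, abs_neg,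
      abs_of_nonneg (h.deriv_nonneg hpos)]

lemma abs_qDeriv_sub_le {lam mu : ℝ} {ρ : ℝ → ℝ} (h : Amenable lam mu ρ) (hlam : 0 < lam)
    {t z : ℝ} (hz1 : |z| ≤ 1) (hz : z * t = |t|) : |qDeriv lam ρ t - lam * z| ≤ lam := by
  rcases eq_or_ne t 0 with rfl | ht
  · rw [qDeriv_zero h, zero_sub, abs_neg, abs_mul, abs_of_pos hlam]
    exact mul_le_of_le_one_right hlam.le hz1
  · rw [abs_qDeriv_sub h ht hz]
    exact h.deriv_le (abs_pos.2 ht)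

lemma abs_le_vecInf {m : Type*} [Fintype m] (x : m → ℝ) (i : m) : |x i| ≤ vecInf x :=
  le_ciSup (f := fun i => |x i|) (Set.finite_range _).bddAbove i

lemma vecInf_nonneg {m : Type*} [Fintype m] (x : m → ℝ) : 0 ≤ vecInf x :=
  Real.iSup_nonneg fun _ => abs_nonneg _

lemma abs_mulVec_le {m n : Type*} [Fintype m] [Fintype n] (M : Matrix m n ℝ) {v : n → ℝ}
    {c : ℝ} (hc : 0 ≤ c) (hv : ∀ j, |v j| ≤ c) (i : m) : |M.mulVec v i| ≤ c * matInf M := by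
  have hrow : ∑ j, |M i j| ≤ matInf M :=
    le_ciSup (f := fun i => ∑ j, |M i j|) (Set.finite_range _).bddAbove i
  calc |M.mulVec v i| ≤ ∑ j, |M i j * v j| := Finset.abs_sum_le_sum_abs _ _
    _ ≤ ∑ j, |M i j| * c := by
      gcongr with j
      rw [abs_mul]
      gcongr
      exact hv j
    _ = c * ∑ j, |M i j| := by rw [← Finset.sum_mul, mul_comm]
    _ ≤ c * matInf M := by gcongr

lemma gradient_apply {p : ℕ} {L : EuclideanSpace ℝ (Fin p) → ℝ}
    (x : EuclideanSpace ℝ (Fin p)) (i : Fin p) :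
    gradient L x i = fderiv ℝ L x (EuclideanSpace.single i 1) := by
  have h : inner ℝ (gradient L x) (EuclideanSpace.single i (1 : ℝ)) =
      fderiv ℝ L x (EuclideanSpace.single i 1) := InnerProductSpace.toDual_symm_apply
  rw [← h, EuclideanSpace.inner_single_right]
  simp

lemma eq_sum_smul_single {p : ℕ} (v : EuclideanSpace ℝ (Fin p)) :
    v = ∑ j, v j • EuclideanSpace.single j (1 : ℝ) := by
  ext i
  simp [Pi.single_apply]

lemma fderiv_eq_sum_gradient {p : ℕ} {L : EuclideanSpace ℝ (Fin p) → ℝ}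
    (x v : EuclideanSpace ℝ (Fin p)) : fderiv ℝ L x v = ∑ j, v j * gradient L x j := by
  conv_lhs => rw [eq_sum_smul_single v]
  simp [gradient_apply]

lemma hess_mulVec {p : ℕ} {L : EuclideanSpace ℝ (Fin p) → ℝ} (hL : ContDiff ℝ 2 L)
    (x v : EuclideanSpace ℝ (Fin p)) (i : Fin p) :
    fderiv ℝ (fderiv ℝ L) x v (EuclideanSpace.single i 1) = ∑ j, hess L x i j * v j := by
  have hsymm : IsSymmSndFDerivAt ℝ L x :=
    hL.contDiffAt.isSymmSndFDerivAt (by simp)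
  rw [hsymm.eq v (EuclideanSpace.single i 1)]
  conv_lhs => rw [eq_sum_smul_single v]
  simp [hess, iteratedFDeriv_two_apply, mul_comm]

lemma continuous_hess {p : ℕ} {L : EuclideanSpace ℝ (Fin p) → ℝ} (hL : ContDiff ℝ 2 L)
    (i j : Fin p) : Continuous fun x => hess L x i j := by
  have hc : Continuous (fderiv ℝ (fderiv ℝ L)) :=
    (hL.fderiv_right (m := 1) (by norm_num)).continuous_fderiv (by norm_num)
  simp only [hess, iteratedFDeriv_two_apply]
  exact (hc.clm_apply continuous_const).clm_apply continuous_const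

/-- The fundamental theorem of calculus for the gradient along a segment. -/
lemma gradient_sub_eq_Qhat {p : ℕ} {L : EuclideanSpace ℝ (Fin p) → ℝ} (hL : ContDiff ℝ 2 L)
    (x y : EuclideanSpace ℝ (Fin p)) (i : Fin p) :
    gradient L y i - gradient L x i = ∑ j, Qhat L x y i j * (y - x) j := by
  have hline : Continuous fun t : ℝ => x + t • (y - x) := by fun_prop
  have hcont : ∀ j, Continuous fun t : ℝ => hess L (x + t • (y - x)) i j := fun j =>
    (continuous_hess hL i j).comp hline
  have hd : ∀ t : ℝ, HasDerivAt (fun t : ℝ => gradient L (x + t • (y - x)) i)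
      (∑ j, hess L (x + t • (y - x)) i j * (y - x) j) t := by
    intro t
    have h1 : HasDerivAt (fun t : ℝ => x + t • (y - x)) (y - x) t := by
      simpa using ((hasDerivAt_id t).smul_const (y - x)).const_add x
    have h2 : HasFDerivAt (fderiv ℝ L) (fderiv ℝ (fderiv ℝ L) (x + t • (y - x)))
        (x + t • (y - x)) :=
      ((hL.fderiv_right (m := 1) (by norm_num)).differentiable (by norm_num) _).hasFDerivAt
    have h3 := (ContinuousLinearMap.apply ℝ ℝ
      (EuclideanSpace.single i (1 : ℝ))).hasFDerivAt.comp_hasDerivAt t (h2.comp_hasDerivAt t h1)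
    simp only [gradient_apply, ← hess_mulVec hL]
    exact h3
  have hint := intervalIntegral.integral_eq_sub_of_hasDerivAt (a := 0) (b := 1)
    (fun t _ => hd t) (Continuous.intervalIntegrable (by fun_prop) _ _)
  rw [intervalIntegral.integral_finsetSum
    (fun j _ => Continuous.intervalIntegrable (by fun_prop) _ _)] at hint
  simp only [intervalIntegral.integral_mul_const, zero_smul, add_zero, one_smul,
    add_sub_cancel] at hint
  exact hint.symm

lemma subSS_mulVec {p : ℕ} (M : Matrix (Fin p) (Fin p) ℝ) (S : Finset (Fin p))
    {v : Fin p → ℝ} (hv : ∀ j ∉ S, v j = 0) (i : {j // j ∈ S}) :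
    (subSS M S).mulVec (fun j => v j) i = ∑ j, M i j * v j := by
  change ∑ j : {j // j ∈ S}, M i j * v j = _
  rw [Finset.sum_coe_sort S fun j => M i j * v j]
  exact Finset.sum_subset (Finset.subset_univ S) fun j _ hj => by rw [hv j hj, mul_zero]

lemma ConvexOn.le_of_fderiv_eq_zero {E : Type*} [NormedAddCommGroup E] [NormedSpace ℝ E]
    {s : Set E} {f : E → ℝ} (hf : ConvexOn ℝ s f) {x y : E} (hx : x ∈ s) (hy : y ∈ s)
    (hd : DifferentiableAt ℝ f x) (h0 : fderiv ℝ f x (y - x) = 0) : f x ≤ f y := by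
  have hline : HasDerivAt (fun t : ℝ => x + t • (y - x)) (y - x) 0 := by
    simpa using ((hasDerivAt_id (0 : ℝ)).smul_const (y - x)).const_add x
  have hderiv : HasDerivAt (fun t : ℝ => f (x + t • (y - x))) 0 0 := by
    have hx0 : HasFDerivAt f (fderiv ℝ f x) (x + (0 : ℝ) • (y - x)) := by
      simpa using hd.hasFDerivAt
    simpa only [h0, Function.comp_def] using hx0.comp_hasDerivAt 0 hline
  have hconv : ConvexOn ℝ (Set.Icc (0 : ℝ) 1) fun t : ℝ => f (x + t • (y - x)) := by
    have h := hf.comp_affineMap (AffineMap.lineMap x y)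
    have hsub : Set.Icc (0 : ℝ) 1 ⊆ AffineMap.lineMap x y ⁻¹' s :=
      fun t ht => hf.1.lineMap_mem hx hy ht
    have h' := h.subset hsub (convex_Icc 0 1)
    refine h'.congr fun t _ => ?_
    simp [AffineMap.lineMap_apply, add_comm]
  have hs := hconv.le_slope_of_hasDerivAt (x := 0) (y := 1) (by simp) (by simp) one_pos hderiv
  simpa [slope_def_field] using hs

lemma StrictConvexOn.lt_of_fderiv_eq_zero {E : Type*} [NormedAddCommGroup E] [NormedSpace ℝ E]
    {s : Set E} {f : E → ℝ} (hf : StrictConvexOn ℝ s f) {x y : E} (hx : x ∈ s) (hy : y ∈ s)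
    (hxy : y ≠ x) (hd : DifferentiableAt ℝ f x)
    (h0 : ∀ z ∈ s, fderiv ℝ f x (z - x) = 0) : f x < f y := by
  have hmid : (1 / 2 : ℝ) • x + (1 / 2 : ℝ) • y ∈ s :=
    hf.1 hx hy (by norm_num) (by norm_num) (by norm_num)
  have hle := hf.convexOn.le_of_fderiv_eq_zero hx hmid hd (h0 _ hmid)
  have hlt := hf.2 hx hy hxy.symm (by norm_num : (0 : ℝ) < 1 / 2)
    (by norm_num : (0 : ℝ) < 1 / 2) (by norm_num)
  simp only [smul_eq_mul] at hlt
  linarith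

/-- oracle property under `(μ, γ)`-amenability and a beta-min condition.
(1) `|β̂ⱼ| ≥ γλ` on `S`; (2) `(∇L(β̂))_S = 0`, so `β̂` is the unique minimizer (the oracle
estimator) of `L` restricted to `{β : supp β ⊆ S}` whenever that restriction is strictly
convex; and (3) `‖β̂ − β*‖_∞ ≤ ‖(Q̂_{SS})⁻¹ (∇L(β*))_S‖_∞`. -/
theorem oracle_ell_inf_bound (p : ℕ) (hp : 0 < p) (S : Finset (Fin p))
    (L : EuclideanSpace ℝ (Fin p) → ℝ) (hL : ContDiff ℝ 2 L)
    (ρ : ℝ → ℝ) (lam mu gam : ℝ) (hlam : 0 < lam) (hmu : 0 ≤ mu) (hgam : 0 < gam)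
    (hρ : AmenableG lam mu gam ρ)
    (βstar βhat : EuclideanSpace ℝ (Fin p))
    (hβstarS : ∀ j, βstar j ≠ 0 → j ∈ S) (hβhatS : ∀ j, βhat j ≠ 0 → j ∈ S)
    (zhat : Fin p → ℝ)
    (hzero : ∀ j, gradient L βhat j - qDeriv lam ρ (βhat j) + lam * zhat j = 0)
    (hzS : (fun j : {j // j ∈ S} => zhat j) ∈ l1Subdiff (fun j : {j // j ∈ S} => βhat j))
    (hinv : IsUnit (subSS (Qhat L βstar βhat) S).det)
    (hbetamin : ∀ j ∈ S,
      lam * (gam + matInf (subSS (Qhat L βstar βhat) S)⁻¹) +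
        vecInf ((subSS (Qhat L βstar βhat) S)⁻¹.mulVec
          (fun j : {j // j ∈ S} => gradient L βstar j)) ≤ |βstar j|) :
    (∀ j ∈ S, gam * lam ≤ |βhat j|) ∧
    (∀ j ∈ S, gradient L βhat j = 0) ∧
    (StrictConvexOn ℝ {β : EuclideanSpace ℝ (Fin p) | ∀ j, β j ≠ 0 → j ∈ S} L →
      ∀ β : EuclideanSpace ℝ (Fin p), (∀ j, β j ≠ 0 → j ∈ S) → β ≠ βhat → L βhat < L β) ∧
    normInf (βhat - βstar) ≤
      vecInf ((subSS (Qhat L βstar βhat) S)⁻¹.mulVec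
        (fun j : {j // j ∈ S} => gradient L βstar j)) := by
  set A := subSS (Qhat L βstar βhat) S with hA
  set B : ℝ := vecInf (A⁻¹.mulVec (fun j : {j // j ∈ S} => gradient L βstar j)) with hB
  have hΔ : ∀ j ∉ S, (βhat - βstar) j = 0 := fun j hj => by
    have h1 : βhat j = 0 := not_not.1 (mt (hβhatS j) hj)
    have h2 : βstar j = 0 := not_not.1 (mt (hβstarS j) hj)
    simp [h1, h2]
  have hz : ∀ j ∈ S, zhat j * βhat j = |βhat j| := fun j hj =>
    mul_eq_abs_of_mem_l1Subdiff hzS ⟨j, hj⟩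
  have hgrad : ∀ j, gradient L βhat j = qDeriv lam ρ (βhat j) - lam * zhat j := fun j => by
    linarith [hzero j]
  have hgrad_le : ∀ j : {j // j ∈ S}, |gradient L βhat j| ≤ lam := fun j => by
    rw [hgrad]
    exact abs_qDeriv_sub_le hρ.toAmenable hlam (hzS.1 j) (hz j j.2)
  have hmul : A.mulVec (fun j : {j // j ∈ S} => (βhat - βstar) j) =
      (fun j : {j // j ∈ S} => gradient L βhat j) -
        fun j : {j // j ∈ S} => gradient L βstar j := by
    ext i
    rw [subSS_mulVec _ _ hΔ, ← gradient_sub_eq_Qhat hL, Pi.sub_apply]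
  have hsol : (fun j : {j // j ∈ S} => (βhat - βstar) j) =
      A⁻¹.mulVec (fun j : {j // j ∈ S} => gradient L βhat j) -
        A⁻¹.mulVec (fun j : {j // j ∈ S} => gradient L βstar j) := by
    rw [← Matrix.mulVec_sub, ← hmul, Matrix.mulVec_mulVec, Matrix.nonsing_inv_mul _ hinv,
      Matrix.one_mulVec]
  have hlower : ∀ j ∈ S, gam * lam ≤ |βhat j| := fun j hj => by
    have heq := congrFun hsol ⟨j, hj⟩
    simp only [Pi.sub_apply] at heq
    have h1 := abs_mulVec_le A⁻¹ hlam.le hgrad_le ⟨j, hj⟩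
    have h2 := abs_le_vecInf (A⁻¹.mulVec (fun j : {j // j ∈ S} => gradient L βstar j)) ⟨j, hj⟩
    have h3 : |(βhat - βstar) j| ≤ lam * matInf A⁻¹ + B := by
      rw [heq]
      exact (abs_sub _ _).trans (add_le_add h1 h2)
    have h4 : |βstar j| - |βhat j| ≤ |(βhat - βstar) j| := by
      rw [PiLp.sub_apply, abs_sub_comm]
      exact abs_sub_abs_le_abs_sub _ _
    linarith [hbetamin j hj]
  have hgrad0 : ∀ j ∈ S, gradient L βhat j = 0 := fun j hj => by
    have hpos : 0 < |βhat j| := (mul_pos hgam hlam).trans_le (hlower j hj)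
    rw [← abs_eq_zero, hgrad, abs_qDeriv_sub hρ.toAmenable (abs_pos.1 hpos) (hz j hj)]
    exact hρ.unbiased _ (hlower j hj)
  refine ⟨hlower, hgrad0, fun hconv β hβ hne => ?_, ?_⟩
  · refine hconv.lt_of_fderiv_eq_zero hβhatS hβ hne
      (hL.differentiable (by norm_num) _) fun z hzs => ?_
    rw [fderiv_eq_sum_gradient]
    refine Finset.sum_eq_zero fun j _ => ?_
    by_cases hj : j ∈ S
    · rw [hgrad0 j hj, mul_zero]
    · have h1 : βhat j = 0 := not_not.1 (mt (hβhatS j) hj)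
      have h2 : z j = 0 := not_not.1 (mt (hzs j) hj)
      simp [h1, h2]
  · refine Real.iSup_le (fun j => ?_) (vecInf_nonneg _)
    by_cases hj : j ∈ S
    · have h0 : (fun j : {j // j ∈ S} => gradient L βhat j) = 0 :=
        funext fun j => hgrad0 j j.2
      rw [h0, Matrix.mulVec_zero, zero_sub] at hsol
      have heq : (βhat - βstar) j = -_ := congrFun hsol ⟨j, hj⟩
      rw [heq, abs_neg]
      exact abs_le_vecInf _ _
    · rw [hΔ j hj, abs_zero]
      exact vecInf_nonneg _
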